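/- arXiv:2510.27581 — 2 statements merged into one kernel-verified Lean document; each statement's English description precedes it below -/
import Mathlib

section
/- Let m₁, m₂ ∈ 𝔽_q[t] be nonzero and distinct. There exists a constant C = C(q, m₁, m₂) > 0 with the following property. Let r ∈ 𝔽_q[t] be nonzero, let b ∈ 𝔽_q[t] with gcd(b, r) = 1, let h₁, h₂ ∈ 𝔽_q[t] be monic and squarefree, and let g ∈ 𝔽_q[t] be monic with g dividing lcm(h₁,h₂)·r. Then |Σ e(m₁a₁/h₁ + m₂a₂/h₂)| ≤ C · τ(g)², where the sum is over pairs (a₁, a₂) of polynomials with deg aᵢ < deg hᵢ, gcd(aᵢ, hᵢ) = 1 for i = 1, 2, and a₁h₂r + a₂h₁r ≡ b·h₁h₂ (mod g·(h₁,h₂)), with (h₁,h₂) the monic greatest common divisor. -/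
open Polynomial
open scoped Classical

noncomputable section

variable (p : ℕ) [Fact p.Prime] (Fq : Type) [Field Fq] [Fintype Fq] [Algebra (ZMod p) Fq]

/-- `t` as an element of `K∞ = 𝔽_q((1/t))`; the exponent of the Hahn series variable records
the power of `1/t`, so that `res x = x.coeff 1` and `ord x = -x.order`. -/
def Kt : LaurentSeries Fq := HahnSeries.single (-1 : ℤ) 1

/-- The Laurent expansion at infinity of a polynomial. -/
def toK (f : Polynomial Fq) : LaurentSeries Fq := Polynomial.aeval (Kt Fq) f

/-- The additive character `e(x) = exp(2πi · tr(res x)/p)` on `K∞`. -/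
def eC (x : LaurentSeries Fq) : ℂ :=
  Complex.exp (2 * Real.pi * Complex.I *
    ((Algebra.trace (ZMod p) Fq (x.coeff 1)).val : ℂ) / (p : ℂ))

/-- The norm `⟨x⟩ = q^(ord x)` on `K∞` (with `⟨0⟩ = 0`). -/
def Knorm (x : LaurentSeries Fq) : ℝ :=
  if x = 0 then 0 else (Fintype.card Fq : ℝ) ^ (-x.order)

/-- The norm `⟨f⟩ = q^(deg f)` of a polynomial (with `⟨0⟩ = 0`). -/
def pnorm (f : Polynomial Fq) : ℝ :=
  if f = 0 then 0 else (Fintype.card Fq : ℝ) ^ f.natDegree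

/-- The divisor function: the number of monic divisors of `f`. -/
def tauP (f : Polynomial Fq) : ℕ := {d : Polynomial Fq | d.Monic ∧ d ∣ f}.ncard

section Character

set_option linter.unusedSectionVars false

lemma eC_eq_stdAddChar (x : LaurentSeries Fq) :
    eC p Fq x = ZMod.stdAddChar (Algebra.trace (ZMod p) Fq (x.coeff 1)) := by
  rw [ZMod.stdAddChar_apply, ZMod.toCircle_apply, eC]

lemma norm_eC (x : LaurentSeries Fq) : ‖eC p Fq x‖ = 1 := by
  rw [eC_eq_stdAddChar, ZMod.stdAddChar_apply, Circle.norm_coe]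

lemma eC_zero : eC p Fq 0 = 1 := by simp [eC_eq_stdAddChar]

lemma eC_add (x y : LaurentSeries Fq) : eC p Fq (x + y) = eC p Fq x * eC p Fq y := by
  simp [eC_eq_stdAddChar, AddChar.map_add_eq_mul]

lemma eC_sum {ι : Type*} (s : Finset ι) (f : ι → LaurentSeries Fq) :
    eC p Fq (∑ i ∈ s, f i) = ∏ i ∈ s, eC p Fq (f i) := by
  induction s using Finset.cons_induction with
  | empty => simp [eC_zero]
  | cons a s ha ih => rw [Finset.sum_cons, Finset.prod_cons, eC_add, ih]

lemma toK_monomial (n : ℕ) (c : Fq) :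
    toK Fq (monomial n c) = HahnSeries.single (-n : ℤ) c := by
  rw [toK, aeval_monomial, Kt, HahnSeries.single_pow]
  simp [HahnSeries.algebraMap_apply']

lemma coeff_toK_neg (f : Fq[X]) (n : ℕ) : (toK Fq f).coeff (-n : ℤ) = f.coeff n := by
  induction f using Polynomial.induction_on' with
  | add f g hf hg => simp_all [toK]
  | monomial m c =>
    rw [toK_monomial, coeff_monomial, HahnSeries.coeff_single]
    simp [eq_comm]

lemma coeff_toK_pos (f : Fq[X]) {n : ℤ} (hn : 0 < n) : (toK Fq f).coeff n = 0 := by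
  induction f using Polynomial.induction_on' with
  | add f g hf hg => simp_all [toK]
  | monomial m c =>
    rw [toK_monomial, HahnSeries.coeff_single_of_ne]
    lia

lemma toK_add (f g : Fq[X]) : toK Fq (f + g) = toK Fq f + toK Fq g := map_add _ _ _
lemma toK_mul (f g : Fq[X]) : toK Fq (f * g) = toK Fq f * toK Fq g := map_mul _ _ _
lemma toK_sum {ι : Type*} (s : Finset ι) (f : ι → Fq[X]) :
    toK Fq (∑ i ∈ s, f i) = ∑ i ∈ s, toK Fq (f i) := map_sum _ _ _

lemma toK_ne_zero {f : Fq[X]} (hf : f ≠ 0) : toK Fq f ≠ 0 := fun h => by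
  have := coeff_toK_neg Fq f f.natDegree
  simp [h] at this
  exact hf (leadingCoeff_eq_zero.1 this.symm)

lemma order_toK {f : Fq[X]} (hf : f ≠ 0) : (toK Fq f).order = -(f.natDegree : ℤ) := by
  apply le_antisymm
  · exact HahnSeries.order_le_of_coeff_ne_zero (by simpa [coeff_toK_neg] using hf)
  · by_contra! h
    refine HahnSeries.coeff_order_eq_zero.not.2 (toK_ne_zero Fq hf) ?_
    obtain ⟨n, hn⟩ : ∃ n : ℕ, (toK Fq f).order = -n := ⟨(-(toK Fq f).order).toNat, by lia⟩
    rw [hn, coeff_toK_neg]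
    exact coeff_eq_zero_of_natDegree_lt (by lia)

lemma eC_toK (f : Fq[X]) : eC p Fq (toK Fq f) = 1 := by
  simp [eC_eq_stdAddChar, coeff_toK_pos]

lemma eC_toK_div_congr {w f g : Fq[X]} (hw : w ≠ 0) (h : w ∣ f - g) :
    eC p Fq (toK Fq f / toK Fq w) = eC p Fq (toK Fq g / toK Fq w) := by
  obtain ⟨k, hk⟩ := h
  have hw' := toK_ne_zero Fq hw
  have : toK Fq f / toK Fq w = toK Fq k + toK Fq g / toK Fq w := by
    rw [sub_eq_iff_eq_add.1 hk, toK_add, toK_mul]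
    field_simp
  rw [this, eC_add, eC_toK, one_mul]

lemma exists_eC_toK_div_ne_one {w : Fq[X]} (hw : w.Monic) (hd : 0 < w.natDegree) :
    ∃ f : Fq[X], eC p Fq (toK Fq f / toK Fq w) ≠ 1 := by
  have : Module.Finite (ZMod p) Fq := Module.Finite.of_finite
  obtain ⟨c, hc⟩ := Algebra.trace_surjective (ZMod p) Fq 1
  have hc0 : c ≠ 0 := by rintro rfl; simp at hc
  set f : Fq[X] := monomial (w.natDegree - 1) c
  have hf : f ≠ 0 := by simpa [f] using hc0
  have hfw := toK_ne_zero Fq hf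
  have hww := toK_ne_zero Fq hw.ne_zero
  have hmul : toK Fq f / toK Fq w * toK Fq w = toK Fq f := div_mul_cancel₀ _ hww
  have hne : toK Fq f / toK Fq w ≠ 0 := div_ne_zero hfw hww
  have hord : (toK Fq f / toK Fq w).order = 1 := by
    have := HahnSeries.order_mul hne hww
    rw [hmul, order_toK Fq hf, order_toK Fq hw.ne_zero, natDegree_monomial_eq _ hc0] at this
    lia
  have hlc : (toK Fq f / toK Fq w).coeff 1 = c := by
    have := HahnSeries.leadingCoeff_mul (toK Fq f / toK Fq w) (toK Fq w)
    rw [hmul, HahnSeries.leadingCoeff_eq, HahnSeries.leadingCoeff_eq, HahnSeries.leadingCoeff_eq,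
      hord, order_toK Fq hf, order_toK Fq hw.ne_zero, coeff_toK_neg, coeff_toK_neg,
      coeff_natDegree, coeff_natDegree, hw.leadingCoeff, mul_one] at this
    rw [← this, leadingCoeff_monomial]
  refine ⟨f, ?_⟩
  rw [eC_eq_stdAddChar, hlc, hc]
  intro h
  exact one_ne_zero (ZMod.injective_stdAddChar (h.trans (AddChar.map_zero_eq_one _).symm))

end Character

/-- The finset of polynomials of degree less than `n`. -/
def polysLT (n : ℕ) : Finset Fq[X] :=
  have : Finite (degreeLT Fq n) := Module.finite_of_finite Fq
  (Set.toFinite (degreeLT Fq n : Set Fq[X])).toFinset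

variable {Fq} in
lemma mem_polysLT {n : ℕ} {f : Fq[X]} : f ∈ polysLT Fq n ↔ f.degree < n := by
  simp [polysLT, mem_degreeLT]

lemma card_polysLT (n : ℕ) : (polysLT Fq n).card = Fintype.card Fq ^ n := by
  have h : (degreeLT Fq n : Set Fq[X]) = polysLT Fq n := by
    ext; simp [mem_polysLT, mem_degreeLT]
  rw [← Set.ncard_coe_finset, ← h, ← Nat.card_coe_set_eq]
  exact (Nat.card_congr (degreeLTEquiv Fq n).toEquiv).trans (by simp)

/-- Orthogonality of the additive characters modulo an irreducible polynomial. -/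
lemma sum_polysLT_eC_eq_zero {w m : Fq[X]} (hw : w.Monic) (hi : Irreducible w) (hm : ¬ w ∣ m) :
    ∑ u ∈ polysLT Fq w.natDegree, eC p Fq (toK Fq (m * u) / toK Fq w) = 0 := by
  have : Finite (degreeLT Fq w.natDegree) := Module.finite_of_finite Fq
  have : Fintype (degreeLT Fq w.natDegree) := Fintype.ofFinite _
  let χ : AddChar (degreeLT Fq w.natDegree) ℂ :=
    { toFun u := eC p Fq (toK Fq (m * u) / toK Fq w)
      map_zero_eq_one' := by simp [toK, eC_zero]
      map_add_eq_mul' u v := by simp [mul_add, toK_add, add_div, eC_add] }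
  have hχ : χ ≠ 1 := by
    obtain ⟨f, hf⟩ := exists_eC_toK_div_ne_one p Fq hw hi.natDegree_pos
    obtain ⟨a, b, hab⟩ := (hi.coprime_iff_not_dvd.2 hm)
    refine AddChar.ne_one_iff.2 ⟨⟨(b * f) %ₘ w, ?_⟩, ?_⟩
    · rw [mem_degreeLT, ← degree_eq_natDegree hw.ne_zero]
      exact degree_modByMonic_lt _ hw
    · change eC p Fq (toK Fq (m * ((b * f) %ₘ w)) / toK Fq w) ≠ 1
      rw [eC_toK_div_congr p Fq hw.ne_zero (g := f)]
      · exact hf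
      · refine ⟨-(m * ((b * f) /ₘ w)) - a * f, ?_⟩
        linear_combination m * modByMonic_add_div (b * f) w + f * hab
  rw [← AddChar.sum_eq_zero_of_ne_one hχ]
  refine Finset.sum_subtype _ (fun u => ?_) (fun u => eC p Fq (toK Fq (m * u) / toK Fq w))
  rw [mem_polysLT, mem_degreeLT]

section Local

/-- The pairs of residues `(u₁, u₂)` modulo `w`, with prescribed vanishing or non-vanishing of
each residue, and prescribed sum when `e` holds. -/
def localPairs (w : Fq[X]) (s₁ s₂ e : Prop) (c : Fq[X]) : Finset (Fq[X] × Fq[X]) :=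
  (polysLT Fq w.natDegree ×ˢ polysLT Fq w.natDegree).filter fun u =>
    (u.1 = 0 ↔ ¬ s₁) ∧ (u.2 = 0 ↔ ¬ s₂) ∧ (e → u.1 + u.2 = c)

lemma norm_sum_eC_le_card {α : Type*} (s : Finset α) (f : α → LaurentSeries Fq) :
    ‖∑ a ∈ s, eC p Fq (f a)‖ ≤ s.card :=
  (norm_sum_le _ _).trans (by simp [norm_eC])

lemma norm_sum_filter_polysLT_le_one {w m : Fq[X]} (hw : w.Monic) (hi : Irreducible w)
    (hm : ¬ w ∣ m) (s : Prop) :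
    ‖∑ u ∈ (polysLT Fq w.natDegree).filter (fun u => u = 0 ↔ ¬ s),
      eC p Fq (toK Fq (m * u) / toK Fq w)‖ ≤ 1 := by
  have h0 : (0 : Fq[X]) ∈ polysLT Fq w.natDegree := by simp [mem_polysLT]
  by_cases hs : s
  · have : (polysLT Fq w.natDegree).filter (fun u => u = 0 ↔ ¬ s) =
        (polysLT Fq w.natDegree).erase 0 := by
      ext u; simp [hs, and_comm]
    rw [this, Finset.sum_erase_eq_sub h0, sum_polysLT_eC_eq_zero p Fq hw hi hm]
    simp [norm_eC]
  · refine (norm_sum_eC_le_card p Fq _ _).trans ?_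
    exact_mod_cast Finset.card_le_one.2 (by simp +contextual [hs])

lemma norm_sum_localPairs_le_of_not_dvd {w m₁ m₂ c : Fq[X]} (hw : w.Monic) (hi : Irreducible w)
    (h₁ : ¬ w ∣ m₁) (h₂ : ¬ w ∣ m₂) (h₁₂ : ¬ w ∣ m₁ - m₂) (hc : c.degree < w.natDegree)
    {s₁ s₂ : Prop} (hs : s₁ ∨ s₂) (e : Prop) :
    ‖∑ u ∈ localPairs Fq w s₁ s₂ e c, eC p Fq (toK Fq (m₁ * u.1 + m₂ * u.2) / toK Fq w)‖ ≤
      if e then 2 else 1 := by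
  by_cases he : e
  · rw [if_pos he]
    by_cases hss : s₁ ∧ s₂
    · have hT : ∑ u ∈ localPairs Fq w s₁ s₂ e c,
          eC p Fq (toK Fq (m₁ * u.1 + m₂ * u.2) / toK Fq w) =
          ∑ u ∈ polysLT Fq w.natDegree \ {0, c},
            eC p Fq (toK Fq (m₂ * c) / toK Fq w) *
              eC p Fq (toK Fq ((m₁ - m₂) * u) / toK Fq w) := by
        refine Finset.sum_nbij' (fun u => u.1) (fun u => (u, c - u)) ?_ ?_ ?_ ?_ ?_
        · rintro ⟨u, v⟩ h
          simp only [localPairs, Finset.mem_filter, Finset.mem_product, he, hss.1, hss.2,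
            Finset.mem_sdiff, Finset.mem_insert, Finset.mem_singleton] at h ⊢
          obtain ⟨⟨h3, h4⟩, h5, h6, h7⟩ := h
          refine ⟨h3, ?_⟩
          rintro (h | h)
          · simp_all
          · have := h7 trivial
            simp_all
        · intro u h
          simp only [localPairs, Finset.mem_filter, Finset.mem_product, he, hss.1, hss.2,
            Finset.mem_sdiff, Finset.mem_insert, Finset.mem_singleton, mem_polysLT] at h ⊢
          push Not at h
          exact ⟨⟨h.1, (degree_sub_le _ _).trans_lt (max_lt hc h.1)⟩, by simp [h.2.1],
            by simp [sub_eq_zero, h.2.2.symm], by simp⟩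
        · rintro ⟨u, v⟩ h
          simp only [localPairs, Finset.mem_filter, he] at h
          simp [← h.2.2.2 trivial]
        · simp
        · rintro ⟨u, v⟩ h
          simp only [localPairs, Finset.mem_filter, he] at h
          rw [← eC_add, ← add_div, ← toK_add, ← h.2.2.2 trivial]
          congr 3
          ring
      have hsub : ({0, c} : Finset Fq[X]) ⊆ polysLT Fq w.natDegree := by
        intro x hx
        rw [mem_polysLT]
        rcases Finset.mem_insert.1 hx with rfl | hx
        · simp
        · rwa [Finset.mem_singleton.1 hx]
      rw [hT, ← Finset.mul_sum, norm_mul, norm_eC, one_mul, Finset.sum_sdiff_eq_sub hsub,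
        sum_polysLT_eC_eq_zero p Fq hw hi h₁₂, zero_sub, norm_neg]
      refine (norm_sum_eC_le_card p Fq _ _).trans ?_
      exact_mod_cast Finset.card_le_two
    · refine (norm_sum_eC_le_card p Fq _ _).trans (le_trans ?_ one_le_two)
      have : (localPairs Fq w s₁ s₂ e c).card ≤ 1 := by
        refine Finset.card_le_one.2 ?_
        rintro ⟨u, v⟩ h ⟨u', v'⟩ h'
        simp only [localPairs, Finset.mem_filter, he] at h h'
        obtain ⟨-, h5, h6, h7⟩ := h
        obtain ⟨-, h5', h6', h7'⟩ := h'
        by_cases h1 : s₁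
        · have h2 : ¬ s₂ := fun h2 => hss ⟨h1, h2⟩
          simp_all
        · simp_all
      exact_mod_cast this
  · rw [if_neg he]
    have hT : localPairs Fq w s₁ s₂ e c =
        (polysLT Fq w.natDegree).filter (fun u => u = 0 ↔ ¬ s₁) ×ˢ
        (polysLT Fq w.natDegree).filter (fun u => u = 0 ↔ ¬ s₂) := by
      ext u; simp [localPairs, he]; tauto
    have : ∀ u : Fq[X] × Fq[X], eC p Fq (toK Fq (m₁ * u.1 + m₂ * u.2) / toK Fq w) =
        eC p Fq (toK Fq (m₁ * u.1) / toK Fq w) * eC p Fq (toK Fq (m₂ * u.2) / toK Fq w) := by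
      intro u
      rw [toK_add, add_div, eC_add]
    simp_rw [this]
    rw [hT, Finset.sum_product]
    dsimp only
    rw [← Finset.sum_mul_sum, norm_mul]
    exact mul_le_one₀ (norm_sum_filter_polysLT_le_one p Fq hw hi h₁ s₁) (norm_nonneg _)
      (norm_sum_filter_polysLT_le_one p Fq hw hi h₂ s₂)

lemma norm_sum_localPairs_le {w m₁ m₂ c : Fq[X]} (hw : w.Monic) (hi : Irreducible w)
    (hc : c.degree < w.natDegree) {s₁ s₂ : Prop} (hs : s₁ ∨ s₂) (e : Prop) :
    ‖∑ u ∈ localPairs Fq w s₁ s₂ e c, eC p Fq (toK Fq (m₁ * u.1 + m₂ * u.2) / toK Fq w)‖ ≤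
      (if w ∣ m₁ * m₂ * (m₁ - m₂) then ((Fintype.card Fq : ℝ) ^ w.natDegree) ^ 2 else 1) *
        if e then 2 else 1 := by
  by_cases hd : w ∣ m₁ * m₂ * (m₁ - m₂)
  · rw [if_pos hd]
    refine (norm_sum_eC_le_card p Fq _ _).trans ?_
    have h : ((localPairs Fq w s₁ s₂ e c).card : ℝ) ≤
        ((Fintype.card Fq : ℝ) ^ w.natDegree) ^ 2 := by
      refine (Nat.cast_le.2 (Finset.card_filter_le _ _)).trans ?_
      rw [Finset.card_product, card_polysLT, sq]
      push_cast
      rfl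
    exact h.trans (le_mul_of_one_le_right (by positivity) (by split_ifs <;> norm_num))
  · rw [if_neg hd, one_mul]
    exact norm_sum_localPairs_le_of_not_dvd p Fq hw hi
      (fun h => hd (by rw [mul_assoc]; exact h.mul_right _))
      (fun h => hd (by rw [mul_assoc]; exact (h.mul_right _).mul_left _))
      (fun h => hd (h.mul_left _)) hc hs e

end Local

section PartialFractions

variable {F ι : Type*} [Field F] [Fintype ι]

/-- The numerator of `∑ i, u i / w i` over the common denominator `∏ i, w i`. -/
def fracNum (w u : ι → F[X]) : F[X] := ∑ i, u i * ∏ j ∈ Finset.univ.erase i, w j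

lemma fracNum_add (w u v : ι → F[X]) : fracNum w (u + v) = fracNum w u + fracNum w v := by
  simp [fracNum, add_mul, Finset.sum_add_distrib]

lemma fracNum_sub (w u v : ι → F[X]) : fracNum w (u - v) = fracNum w u - fracNum w v := by
  simp [fracNum, sub_mul]

variable {w : ι → F[X]}

lemma isCoprime_of_monic_irreducible {f g : F[X]} (hf : f.Monic) (hg : g.Monic)
    (hfi : Irreducible f) (hgi : Irreducible g) (h : f ≠ g) : IsCoprime f g :=
  hfi.coprime_iff_not_dvd.2 fun hd =>
    h (eq_of_monic_of_associated hf hg ((hfi.dvd_irreducible_iff_associated hgi).1 hd))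

lemma dvd_fracNum_iff (hc : Pairwise fun i j => IsCoprime (w i) (w j)) (u : ι → F[X]) (i : ι) :
    w i ∣ fracNum w u ↔ w i ∣ u i := by
  rw [fracNum, ← Finset.add_sum_erase _ _ (Finset.mem_univ i), dvd_add_left]
  · refine ⟨IsCoprime.dvd_of_dvd_mul_right (IsCoprime.prod_right fun j hj => hc ?_),
      fun h => h.mul_right _⟩
    exact (Finset.ne_of_mem_erase hj).symm
  · refine Finset.dvd_sum fun j hj => (Finset.dvd_prod_of_mem w ?_).mul_left _
    simpa using (Finset.ne_of_mem_erase hj).symm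

lemma degree_fracNum_lt (hw : ∀ i, (w i).Monic) {u : ι → F[X]}
    (hu : ∀ i, (u i).degree < (w i).natDegree) :
    (fracNum w u).degree < (∏ i, w i).natDegree := by
  rw [fracNum, ← mem_degreeLT]
  refine Submodule.sum_mem _ fun i _ => ?_
  have hm : (∏ j ∈ Finset.univ.erase i, w j).Monic := monic_prod_of_monic _ _ fun j _ => hw j
  rw [mem_degreeLT, ← Finset.mul_prod_erase _ _ (Finset.mem_univ i), (hw i).natDegree_mul hm,
    degree_mul, degree_eq_natDegree hm.ne_zero, Nat.cast_add]
  exact WithBot.add_lt_add_right (by simp) (hu i)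

lemma exists_fracNum_eq (hw : ∀ i, (w i).Monic)
    (hc : Pairwise fun i j => IsCoprime (w i) (w j)) {f : F[X]}
    (hf : f.degree < (∏ i, w i).natDegree) :
    ∃ u : ι → F[X], (∀ i, (u i).degree < (w i).natDegree) ∧ fracNum w u = f := by
  obtain ⟨q, u, hu, h⟩ := eq_quo_mul_prod_add_sum_rem_mul_prod (s := Finset.univ) f (g := w)
    (fun i _ => hw i) (fun i _ j _ hij => hc hij)
  have hu' : ∀ i, (u i).degree < (w i).natDegree := fun i => by
    rw [← degree_eq_natDegree (hw i).ne_zero]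
    exact hu i (Finset.mem_univ i)
  refine ⟨u, hu', ?_⟩
  have hm : (∏ i, w i).Monic := monic_prod_of_monic _ _ fun i _ => hw i
  have hd : ∏ i, w i ∣ f - fracNum w u := ⟨q, by rw [h, fracNum]; ring⟩
  refine (sub_eq_zero.1 (eq_zero_of_dvd_of_degree_lt hd ?_)).symm
  rw [degree_eq_natDegree hm.ne_zero]
  exact (degree_sub_le _ _).trans_lt (max_lt hf (degree_fracNum_lt hw hu'))

lemma dvd_iff_eq_zero_of_degree_lt {f g : F[X]} (h : g.degree < f.natDegree) :
    f ∣ g ↔ g = 0 := by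
  refine ⟨fun hd => ?_, by rintro rfl; simp⟩
  rcases eq_or_ne f 0 with rfl | hf
  · exact zero_dvd_iff.1 hd
  · exact eq_zero_of_dvd_of_degree_lt hd (by rwa [degree_eq_natDegree hf])

lemma fracNum_injOn (hc : Pairwise fun i j => IsCoprime (w i) (w j)) {u v : ι → F[X]}
    (hu : ∀ i, (u i).degree < (w i).natDegree) (hv : ∀ i, (v i).degree < (w i).natDegree)
    (h : fracNum w u = fracNum w v) : u = v := by
  ext1 i
  have := (dvd_fracNum_iff hc (u - v) i).1 (by simp [fracNum_sub, h])
  rw [dvd_iff_eq_zero_of_degree_lt] at this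
  · exact sub_eq_zero.1 this
  · exact (degree_sub_le _ _).trans_lt (max_lt (hu i) (hv i))

end PartialFractions

section Factorization

variable {Fq} {ι : Type} [Fintype ι] {w : ι → Fq[X]}

lemma toK_fracNum_div (hw : ∀ i, (w i).Monic) (u : ι → Fq[X]) :
    toK Fq (fracNum w u) / toK Fq (∏ i, w i) = ∑ i, toK Fq (u i) / toK Fq (w i) := by
  rw [fracNum, toK_sum, Finset.sum_div]
  refine Finset.sum_congr rfl fun i _ => ?_
  rw [← Finset.mul_prod_erase _ w (Finset.mem_univ i), toK_mul, toK_mul, mul_div_mul_right]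
  exact toK_ne_zero Fq (monic_prod_of_monic _ _ fun j _ => hw j).ne_zero

/-- The pairs of residues modulo `∏ i, w i` subject to conditions modulo each `w i`. -/
def globalPairs (w : ι → Fq[X]) (s₁ s₂ e : ι → Prop) (N : Fq[X]) : Finset (Fq[X] × Fq[X]) :=
  (polysLT Fq (∏ i, w i).natDegree ×ˢ polysLT Fq (∏ i, w i).natDegree).filter fun A =>
    ∀ i, (w i ∣ A.1 ↔ ¬ s₁ i) ∧ (w i ∣ A.2 ↔ ¬ s₂ i) ∧ (e i → w i ∣ A.1 + A.2 - N)

lemma mem_globalPairs {s₁ s₂ e : ι → Prop} {N : Fq[X]} {A : Fq[X] × Fq[X]} :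
    A ∈ globalPairs w s₁ s₂ e N ↔
      (A.1.degree < (∏ i, w i).natDegree ∧ A.2.degree < (∏ i, w i).natDegree) ∧
      ∀ i, (w i ∣ A.1 ↔ ¬ s₁ i) ∧ (w i ∣ A.2 ↔ ¬ s₂ i) ∧ (e i → w i ∣ A.1 + A.2 - N) := by
  simp only [globalPairs, Finset.mem_filter, Finset.mem_product, mem_polysLT]

lemma sum_globalPairs_eq_prod (hw : ∀ i, (w i).Monic)
    (hc : Pairwise fun i j => IsCoprime (w i) (w j)) (s₁ s₂ e : ι → Prop) {c : ι → Fq[X]}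
    (hcd : ∀ i, (c i).degree < (w i).natDegree) (m₁ m₂ : Fq[X]) :
    ∑ A ∈ globalPairs w s₁ s₂ e (fracNum w c),
      eC p Fq (toK Fq (m₁ * A.1 + m₂ * A.2) / toK Fq (∏ i, w i)) =
    ∏ i, ∑ u ∈ localPairs Fq (w i) (s₁ i) (s₂ i) (e i) (c i),
      eC p Fq (toK Fq (m₁ * u.1 + m₂ * u.2) / toK Fq (w i)) := by
  have hiff : ∀ u₁ u₂ : ι → Fq[X], (∀ i, (u₁ i).degree < (w i).natDegree) →
      (∀ i, (u₂ i).degree < (w i).natDegree) → ∀ i,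
      ((w i ∣ fracNum w u₁ ↔ ¬ s₁ i) ∧ (w i ∣ fracNum w u₂ ↔ ¬ s₂ i) ∧
        (e i → w i ∣ fracNum w u₁ + fracNum w u₂ - fracNum w c) ↔
      (u₁ i = 0 ↔ ¬ s₁ i) ∧ (u₂ i = 0 ↔ ¬ s₂ i) ∧ (e i → u₁ i + u₂ i = c i)) := by
    intro u₁ u₂ h₁ h₂ i
    rw [← fracNum_add, ← fracNum_sub, dvd_fracNum_iff hc, dvd_fracNum_iff hc, dvd_fracNum_iff hc,
      dvd_iff_eq_zero_of_degree_lt (h₁ i), dvd_iff_eq_zero_of_degree_lt (h₂ i),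
      dvd_iff_eq_zero_of_degree_lt, ← sub_eq_zero (b := c i)]
    · rfl
    · exact (degree_sub_le _ _).trans_lt
        (max_lt ((degree_add_le _ _).trans_lt (max_lt (h₁ i) (h₂ i))) (hcd i))
  rw [Finset.prod_univ_sum]
  symm
  refine Finset.sum_bij (fun u _ => (fracNum w fun i => (u i).1, fracNum w fun i => (u i).2))
    ?_ ?_ ?_ ?_
  · intro u hu
    simp only [Fintype.mem_piFinset, localPairs, Finset.mem_filter, Finset.mem_product,
      mem_polysLT] at hu
    rw [mem_globalPairs]
    refine ⟨⟨degree_fracNum_lt hw fun i => (hu i).1.1, degree_fracNum_lt hw fun i => (hu i).1.2⟩,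
      fun i => ?_⟩
    exact (hiff _ _ (fun i => (hu i).1.1) (fun i => (hu i).1.2) i).2 (hu i).2
  · intro u hu v hv h
    simp only [Fintype.mem_piFinset, localPairs, Finset.mem_filter, Finset.mem_product,
      mem_polysLT] at hu hv
    obtain ⟨h1, h2⟩ := Prod.mk.inj h
    ext1 i
    exact Prod.ext
      (congrFun (fracNum_injOn hc (fun i => (hu i).1.1) (fun i => (hv i).1.1) h1) i)
      (congrFun (fracNum_injOn hc (fun i => (hu i).1.2) (fun i => (hv i).1.2) h2) i)
  · rintro ⟨A₁, A₂⟩ hA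
    rw [mem_globalPairs] at hA
    obtain ⟨u₁, h₁, rfl⟩ := exists_fracNum_eq hw hc hA.1.1
    obtain ⟨u₂, h₂, rfl⟩ := exists_fracNum_eq hw hc hA.1.2
    refine ⟨fun i => (u₁ i, u₂ i), ?_, rfl⟩
    simp only [Fintype.mem_piFinset, localPairs, Finset.mem_filter, Finset.mem_product,
      mem_polysLT]
    exact fun i => ⟨⟨h₁ i, h₂ i⟩, (hiff _ _ h₁ h₂ i).1 (hA.2 i)⟩
  · intro u hu
    have : m₁ * fracNum w (fun i => (u i).1) + m₂ * fracNum w (fun i => (u i).2) =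
        fracNum w fun i => m₁ * (u i).1 + m₂ * (u i).2 := by
      simp only [fracNum, Finset.mul_sum, ← Finset.sum_add_distrib]
      exact Finset.sum_congr rfl fun i _ => by ring
    rw [this, toK_fracNum_div hw, eC_sum]

lemma norm_sum_globalPairs_le (hw : ∀ i, (w i).Monic) (hi : ∀ i, Irreducible (w i))
    (hc : Pairwise fun i j => IsCoprime (w i) (w j)) {s₁ s₂ : ι → Prop} (hs : ∀ i, s₁ i ∨ s₂ i)
    (e : ι → Prop) {N : Fq[X]} (hN : N.degree < (∏ i, w i).natDegree) {m₁ m₂ : Fq[X]}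
    (hm : m₁ * m₂ * (m₁ - m₂) ≠ 0) :
    ‖∑ A ∈ globalPairs w s₁ s₂ e N,
      eC p Fq (toK Fq (m₁ * A.1 + m₂ * A.2) / toK Fq (∏ i, w i))‖ ≤
    ((Fintype.card Fq : ℝ) ^ (m₁ * m₂ * (m₁ - m₂)).natDegree) ^ 2 *
      2 ^ (Finset.univ.filter e).card := by
  obtain ⟨c, hcd, rfl⟩ := exists_fracNum_eq hw hc hN
  rw [sum_globalPairs_eq_prod p hw hc s₁ s₂ e hcd, norm_prod]
  refine (Finset.prod_le_prod (fun _ _ => norm_nonneg _) fun i _ =>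
    norm_sum_localPairs_le p Fq (hw i) (hi i) (hcd i) (hs i) (e i)).trans ?_
  rw [Finset.prod_mul_distrib, ← Finset.prod_filter, ← Finset.prod_filter, Finset.prod_const]
  gcongr
  rw [Finset.prod_pow, Finset.prod_pow_eq_pow_sum]
  have hdvd : ∏ i with w i ∣ m₁ * m₂ * (m₁ - m₂), w i ∣ m₁ * m₂ * (m₁ - m₂) :=
    Finset.prod_dvd_of_coprime (fun i _ j _ hij => hc hij) (by simp)
  have hdeg := natDegree_le_of_dvd hdvd hm
  rw [natDegree_prod_of_monic _ _ fun i _ => hw i] at hdeg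
  gcongr
  exact_mod_cast Fintype.card_pos

end Factorization

section Divisibility

variable {F : Type*} [Field F]

lemma dvd_of_dvd_prod_of_irreducible_dvd {P : Finset F[X]} (hi : ∀ w ∈ P, Irreducible w)
    (hc : (P : Set F[X]).Pairwise IsCoprime) {f g : F[X]} (hf : f ∣ ∏ w ∈ P, w)
    (h : ∀ w ∈ P, w ∣ f → w ∣ g) : f ∣ g := by
  rw [← Finset.prod_filter_mul_prod_filter_not P (fun w => w ∣ f)] at hf
  refine (IsCoprime.dvd_of_dvd_mul_right (IsCoprime.prod_right fun w hw => ?_) hf).trans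
    (Finset.prod_dvd_of_coprime (s := fun w => w) ?_ ?_)
  · rw [Finset.mem_filter] at hw
    exact ((hi w hw.1).coprime_iff_not_dvd.2 hw.2).symm
  · exact hc.mono fun w hw => (Finset.mem_filter.1 hw).1
  · intro w hw
    rw [Finset.mem_filter] at hw
    exact h w hw.1 hw.2

lemma exists_prod_irreducible_eq {h : F[X]} (hm : h.Monic) (hs : Squarefree h) :
    ∃ P : Finset F[X], (∀ w ∈ P, w.Monic ∧ Irreducible w) ∧ ∏ w ∈ P, w = h := by
  have h1 : ∀ w ∈ (UniqueFactorizationMonoid.normalizedFactors h).toFinset,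
      w.Monic ∧ Irreducible w := by
    intro w hw
    rw [Multiset.mem_toFinset] at hw
    have hi := UniqueFactorizationMonoid.irreducible_of_normalized_factor w hw
    refine ⟨?_, hi⟩
    rw [← UniqueFactorizationMonoid.normalize_normalized_factor w hw]
    exact monic_normalize hi.ne_zero
  refine ⟨_, h1, eq_of_monic_of_associated (monic_prod_of_monic _ _ fun w hw => (h1 w hw).1) hm ?_⟩
  refine .trans ?_ (UniqueFactorizationMonoid.prod_normalizedFactors hm.ne_zero)
  rw [Finset.prod, Multiset.map_id', Multiset.toFinset_val, Multiset.dedup_eq_self.2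
    ((UniqueFactorizationMonoid.squarefree_iff_nodup_normalizedFactors hm.ne_zero).1 hs)]

lemma exists_coprime_part {g r : F[X]} (hg : g ≠ 0) :
    ∃ g' : F[X], g' ∣ g ∧ ∀ f, g ∣ f * r ↔ g' ∣ f := by
  obtain ⟨x, y, hx, hy, hu⟩ := extract_gcd g r
  have hG : gcd g r ≠ 0 := fun h => hg (by rw [hx, h, zero_mul])
  refine ⟨x, ⟨gcd g r, by rw [mul_comm]; exact hx⟩, fun f => ?_⟩
  have hco : IsCoprime x y := (gcd_isUnit_iff x y).1 hu
  have : g ∣ f * r ↔ gcd g r * x ∣ gcd g r * (f * y) := by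
    rw [← hx, mul_left_comm, ← hy]
  rw [this, mul_dvd_mul_iff_left hG]
  exact ⟨hco.dvd_of_dvd_mul_right, fun h => h.mul_right _⟩

/-- Multiplication by the complementary factor turns residues coprime to `∏ w ∈ Q, w` into
residues modulo `∏ w ∈ P, w` divisible by exactly the `w ∈ P \ Q`. -/
lemma degree_lt_and_isCoprime_iff {P Q : Finset F[X]} (hQ : Q ⊆ P)
    (hP : ∀ w ∈ P, w.Monic ∧ Irreducible w) (hc : (P : Set F[X]).Pairwise IsCoprime) (a : F[X]) :
    (a.degree < (∏ w ∈ Q, w).degree ∧ IsCoprime a (∏ w ∈ Q, w)) ↔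
      (a * ∏ w ∈ P \ Q, w).degree < (∏ w ∈ P, w).natDegree ∧
        ∀ w ∈ P, (w ∣ a * ∏ w ∈ P \ Q, w ↔ ¬ w ∈ Q) := by
  have hm : ∀ R ⊆ P, (∏ w ∈ R, w).Monic := fun R hR =>
    monic_prod_of_monic _ _ fun w hw => (hP w (hR hw)).1
  refine and_congr ?_ ?_
  · rw [← degree_eq_natDegree (hm P subset_rfl).ne_zero, ← Finset.prod_sdiff hQ, degree_mul,
      degree_mul, add_comm (degree (∏ w ∈ P \ Q, w)), WithBot.add_lt_add_iff_right]
    simpa using (hm (P \ Q) Finset.sdiff_subset).ne_zero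
  · rw [IsCoprime.prod_right_iff]
    have key : ∀ w ∈ Q, (w ∣ a * ∏ w ∈ P \ Q, w ↔ w ∣ a) := fun w hw =>
      ⟨IsCoprime.dvd_of_dvd_mul_right (IsCoprime.prod_right fun v hv =>
        hc (hQ hw) (Finset.mem_sdiff.1 hv).1 (by rintro rfl; simp_all)), fun h => h.mul_right _⟩
    refine ⟨fun h w hw => ?_, fun h w hw => ?_⟩
    · by_cases hwQ : w ∈ Q
      · simpa [key w hwQ, hwQ] using (hP w hw).2.coprime_iff_not_dvd.1 (h w hwQ).symm
      · refine iff_of_true ((Finset.dvd_prod_of_mem (fun w => w) ?_).mul_left _) hwQ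
        simp [hw, hwQ]
    · refine ((hP w (hQ hw)).2.coprime_iff_not_dvd.2 ?_).symm
      rw [← key w hw, h w (hQ hw)]
      simpa using hw

lemma prod_sdiff_dvd {P Q : Finset F[X]} (hc : (P : Set F[X]).Pairwise IsCoprime) {A : F[X]}
    (hA : ∀ w ∈ P, (w ∣ A ↔ ¬ w ∈ Q)) : ∏ w ∈ P \ Q, w ∣ A := by
  refine Finset.prod_dvd_of_coprime (s := fun w => w) (hc.mono (by simp)) fun w hw => ?_
  rw [Finset.mem_sdiff] at hw
  exact (hA w hw.1).2 hw.2

lemma associated_lcm_prod_union [DecidableEq F] {P Q : Finset F[X]}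
    (hc : ((P ∪ Q : Finset F[X]) : Set F[X]).Pairwise IsCoprime) :
    Associated (lcm (∏ w ∈ P, w) (∏ w ∈ Q, w)) (∏ w ∈ P ∪ Q, w) := by
  refine associated_of_dvd_dvd (lcm_dvd
    (Finset.prod_dvd_prod_of_subset _ _ _ Finset.subset_union_left)
    (Finset.prod_dvd_prod_of_subset _ _ _ Finset.subset_union_right))
    (Finset.prod_dvd_of_coprime (s := fun w => w) hc fun w hw => ?_)
  rcases Finset.mem_union.1 hw with h | h
  · exact (Finset.dvd_prod_of_mem (fun w => w) h).trans (dvd_lcm_left _ _)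
  · exact (Finset.dvd_prod_of_mem (fun w => w) h).trans (dvd_lcm_right _ _)

end Divisibility

lemma two_pow_card_le_tauP {g : Fq[X]} (hg : g ≠ 0) {Q : Finset Fq[X]}
    (hQ : ∀ w ∈ Q, w.Monic ∧ Irreducible w) (hd : ∀ w ∈ Q, w ∣ g) :
    2 ^ Q.card ≤ tauP Fq g := by
  have hc : (Q : Set Fq[X]).Pairwise IsCoprime := fun v hv w hw h =>
    isCoprime_of_monic_irreducible (hQ v hv).1 (hQ w hw).1 (hQ v hv).2 (hQ w hw).2 h
  have hfin : {d : Fq[X] | d.Monic ∧ d ∣ g}.Finite := by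
    refine (polysLT Fq (g.natDegree + 1)).finite_toSet.subset fun d hd => ?_
    rw [Finset.mem_coe, mem_polysLT]
    refine degree_le_natDegree.trans_lt ?_
    exact_mod_cast Nat.lt_succ_of_le (natDegree_le_of_dvd hd.2 hg)
  rw [← Finset.card_powerset, ← Set.ncard_coe_finset, tauP]
  refine Set.ncard_le_ncard_of_injOn (fun s => ∏ w ∈ s, w) (fun s hs => ?_) ?_ hfin
  · rw [Finset.mem_coe, Finset.mem_powerset] at hs
    exact ⟨monic_prod_of_monic _ _ fun w hw => (hQ w (hs hw)).1,
      Finset.prod_dvd_of_coprime (s := fun w => w) (hc.mono (by simpa using hs))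
        fun w hw => hd w (hs hw)⟩
  · have key : ∀ s ⊆ Q, ∀ w ∈ Q, (w ∣ ∏ v ∈ s, v ↔ w ∈ s) := by
      refine fun s hs w hw => ⟨fun h => ?_, fun h => Finset.dvd_prod_of_mem (fun v => v) h⟩
      by_contra hws
      refine (hQ w hw).2.coprime_iff_not_dvd.1 (IsCoprime.prod_right fun v hv => ?_) h
      exact hc hw (hs hv) (by rintro rfl; exact hws hv)
    intro s hs t ht hst
    change ∏ w ∈ s, w = ∏ w ∈ t, w at hst
    rw [Finset.mem_coe, Finset.mem_powerset] at hs ht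
    ext w
    refine ⟨fun h => ?_, fun h => ?_⟩
    · rw [← key t ht w (hs h)]
      exact hst ▸ (key s hs w (hs h)).2 h
    · rw [← key s hs w (ht h)]
      exact hst ▸ (key t ht w (ht h)).2 h

/-- Twisted Kloosterman-type bound: for distinct nonzero `m₁, m₂`, squarefree monic `h₁, h₂`,
`(b,r) = 1`, and monic `g ∣ lcm(h₁,h₂)·r`,
`|Σ e(m₁a₁/h₁ + m₂a₂/h₂)| ≤ C·τ(g)²`, the sum over pairs `(a₁,a₂)` with `deg aᵢ < deg hᵢ`,
`gcd(aᵢ,hᵢ) = 1` and `a₁h₂r + a₂h₁r ≡ b·h₁h₂ (mod g·(h₁,h₂))`. -/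
theorem divisor_special_sum_bound (m₁ m₂ : Polynomial Fq)
    (hm₁ : m₁ ≠ 0) (hm₂ : m₂ ≠ 0) (hm : m₁ ≠ m₂) :
    ∃ C : ℝ, 0 < C ∧
      ∀ (r b h₁ h₂ g : Polynomial Fq),
        r ≠ 0 → IsCoprime b r →
        h₁.Monic → Squarefree h₁ → h₂.Monic → Squarefree h₂ →
        g.Monic → g ∣ lcm h₁ h₂ * r →
        ‖∑ᶠ a ∈ {a : Polynomial Fq × Polynomial Fq |
            a.1.degree < h₁.degree ∧ a.2.degree < h₂.degree ∧
            IsCoprime a.1 h₁ ∧ IsCoprime a.2 h₂ ∧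
            g * gcd h₁ h₂ ∣ (a.1 * h₂ * r + a.2 * h₁ * r - b * h₁ * h₂)},
          eC p Fq (toK Fq (m₁ * a.1) / toK Fq h₁ + toK Fq (m₂ * a.2) / toK Fq h₂)‖ ≤
          C * (tauP Fq g : ℝ) ^ 2 := by
  have hM : m₁ * m₂ * (m₁ - m₂) ≠ 0 := mul_ne_zero (mul_ne_zero hm₁ hm₂) (sub_ne_zero.2 hm)
  refine ⟨((Fintype.card Fq : ℝ) ^ (m₁ * m₂ * (m₁ - m₂)).natDegree) ^ 2, ?_, ?_⟩
  · have : 0 < Fintype.card Fq := Fintype.card_pos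
    positivity
  intro r b h₁ h₂ g _ _ hh₁ hs₁ hh₂ hs₂ hg hgL
  obtain ⟨P₁, hP₁, rfl⟩ := exists_prod_irreducible_eq hh₁ hs₁
  obtain ⟨P₂, hP₂, rfl⟩ := exists_prod_irreducible_eq hh₂ hs₂
  set S : Set (Fq[X] × Fq[X]) := {a | _} with hS
  clear_value S
  rcases S.eq_empty_or_nonempty with hSe | ⟨a₀, ha₀⟩
  · rw [hSe, finsum_mem_empty, norm_zero]
    positivity
  set P := P₁ ∪ P₂
  have hP : ∀ w ∈ P, w.Monic ∧ Irreducible w := fun w hw =>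
    (Finset.mem_union.1 hw).elim (hP₁ w) (hP₂ w)
  have hc : (P : Set Fq[X]).Pairwise IsCoprime := fun v hv w hw h =>
    isCoprime_of_monic_irreducible (hP v hv).1 (hP w hw).1 (hP v hv).2 (hP w hw).2 h
  have hsub₁ : P₁ ⊆ P := Finset.subset_union_left
  have hsub₂ : P₂ ⊆ P := Finset.subset_union_right
  have hL₁ : (∏ w ∈ P₁, w) * ∏ w ∈ P \ P₁, w = ∏ w ∈ P, w := by
    rw [mul_comm, Finset.prod_sdiff hsub₁]
  have hL₂ : (∏ w ∈ P₂, w) * ∏ w ∈ P \ P₂, w = ∏ w ∈ P, w := by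
    rw [mul_comm, Finset.prod_sdiff hsub₂]
  have hlcm : Associated (lcm (∏ w ∈ P₁, w) (∏ w ∈ P₂, w)) (∏ w ∈ P, w) :=
    associated_lcm_prod_union hc
  obtain ⟨ε, hε⟩ := (Associated.mul_left (gcd (∏ w ∈ P₁, w) (∏ w ∈ P₂, w)) hlcm).symm.trans
    (gcd_mul_lcm (∏ w ∈ P₁, w) (∏ w ∈ P₂, w))
  have hk₁ne : ∏ w ∈ P \ P₁, w ≠ 0 :=
    Finset.prod_ne_zero_iff.2 fun w hw => (hP w (Finset.mem_sdiff.1 hw).1).2.ne_zero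
  have hk₂ne : ∏ w ∈ P \ P₂, w ≠ 0 :=
    Finset.prod_ne_zero_iff.2 fun w hw => (hP w (Finset.mem_sdiff.1 hw).1).2.ne_zero
  have hcoord₁ := degree_lt_and_isCoprime_iff hsub₁ hP hc
  have hcoord₂ := degree_lt_and_isCoprime_iff hsub₂ hP hc
  have hdvd₁ := fun A => prod_sdiff_dvd (Q := P₁) hc (A := A)
  have hdvd₂ := fun A => prod_sdiff_dvd (Q := P₂) hc (A := A)
  have hDne : gcd (∏ w ∈ P₁, w) (∏ w ∈ P₂, w) ≠ 0 := fun h =>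
    hh₁.ne_zero ((gcd_eq_zero_iff _ _).1 h).1
  have htau := fun (Q : Finset Fq[X]) (hQ : Q ⊆ P) => two_pow_card_le_tauP Fq hg.ne_zero
    (Q := Q) (fun w hw => hP w (hQ hw))
  have hLprod : ∏ i : P, (i : Fq[X]) = ∏ w ∈ P, w := Finset.prod_coe_sort P fun w => w
  obtain ⟨g', hg'g, hg'⟩ := exists_coprime_part (r := r) hg.ne_zero
  have hg'L : g' ∣ ∏ w ∈ P, w :=
    (hg' _).1 (hgL.trans (mul_dvd_mul_right hlcm.dvd r))
  generalize gcd (∏ w ∈ P₁, w) (∏ w ∈ P₂, w) = D at *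
  have hLi : ∀ f : Fq[X], (∀ w ∈ P, w ∣ g' → w ∣ f) ↔ g' ∣ f := fun f =>
    ⟨dvd_of_dvd_prod_of_irreducible_dvd (fun w hw => (hP w hw).2) hc hg'L,
      fun h w _ hw => hw.trans h⟩
  generalize ∏ w ∈ P, w = L at *
  generalize ∏ w ∈ P \ P₁, w = k₂ at *
  generalize ∏ w ∈ P \ P₂, w = k₁ at *
  generalize ∏ w ∈ P₁, w = h₁ at *
  generalize ∏ w ∈ P₂, w = h₂ at *
  have he₂ : D * k₂ * ε = h₂ := mul_left_cancel₀ hh₁.ne_zero (by rw [← hε, ← hL₁]; ring)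
  have he₁ : D * k₁ * ε = h₁ := mul_left_cancel₀ hh₂.ne_zero (by
    rw [mul_comm h₂ h₁, ← hε, ← hL₂]; ring)
  have ha₀' := ha₀
  rw [hS, Set.mem_ofPred_eq] at ha₀'
  set N := a₀.1 * k₂ + a₀.2 * k₁ with hN
  have hcongr : ∀ a : Fq[X] × Fq[X],
      g * D ∣ a.1 * h₂ * r + a.2 * h₁ * r - b * h₁ * h₂ ↔
        ∀ w ∈ P, w ∣ g' → w ∣ a.1 * k₂ + a.2 * k₁ - N := by
    intro a
    have hdiff : a.1 * h₂ * r + a.2 * h₁ * r - b * h₁ * h₂ -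
        (a₀.1 * h₂ * r + a₀.2 * h₁ * r - b * h₁ * h₂) =
        (a.1 * k₂ + a.2 * k₁ - N) * r * D * ε := by
      rw [← he₁, ← he₂, hN]
      ring
    rw [hLi, ← hg', ← dvd_sub_left ha₀'.2.2.2.2, hdiff, Units.dvd_mul_right,
      mul_dvd_mul_iff_right hDne]
  have hbij : Set.BijOn (fun a : Fq[X] × Fq[X] => (a.1 * k₂, a.2 * k₁)) S
      (globalPairs (fun i : P => (i : Fq[X])) (fun i => i.1 ∈ P₁) (fun i => i.1 ∈ P₂)
        (fun i => i.1 ∣ g') N) := by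
    have hmem : ∀ a : Fq[X] × Fq[X], a ∈ S ↔ (a.1 * k₂, a.2 * k₁) ∈
        globalPairs (fun i : P => (i : Fq[X])) (fun i => i.1 ∈ P₁) (fun i => i.1 ∈ P₂)
          (fun i => i.1 ∣ g') N := by
      intro a
      rw [hS, Set.mem_ofPred_eq, hcongr, mem_globalPairs]
      simp only [hLprod, Subtype.forall]
      have h1 := hcoord₁ a.1
      have h2 := hcoord₂ a.2
      grind
    refine ⟨fun a ha => (hmem a).1 ha, fun a _ a' _ h => ?_, fun A hA => ?_⟩
    · obtain ⟨h1, h2⟩ := Prod.mk.inj h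
      exact Prod.ext (mul_right_cancel₀ hk₁ne h1) (mul_right_cancel₀ hk₂ne h2)
    · have hA' := (mem_globalPairs.1 (Finset.mem_coe.1 hA)).2
      obtain ⟨a₁, h1⟩ := hdvd₁ A.1 fun w hw => (hA' ⟨w, hw⟩).1
      obtain ⟨a₂, h2⟩ := hdvd₂ A.2 fun w hw => (hA' ⟨w, hw⟩).2.1
      have hAe : A = (a₁ * k₂, a₂ * k₁) := Prod.ext (by rw [h1, mul_comm]) (by rw [h2, mul_comm])
      exact ⟨(a₁, a₂), (hmem _).2 (hAe ▸ hA), hAe.symm⟩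
  have hNdeg : N.degree < (∏ i : P, (i : Fq[X])).natDegree := by
    rw [hLprod]
    exact (degree_add_le _ _).trans_lt (max_lt ((hcoord₁ a₀.1).1 ⟨ha₀'.1, ha₀'.2.2.1⟩).1
      ((hcoord₂ a₀.2).1 ⟨ha₀'.2.1, ha₀'.2.2.2.1⟩).1)
  have hbound := norm_sum_globalPairs_le p (w := fun i : P => (i : Fq[X]))
    (fun i => (hP i i.2).1) (fun i => (hP i i.2).2)
    (fun i j hij => hc i.2 j.2 (Subtype.coe_injective.ne hij))
    (s₁ := fun i => i.1 ∈ P₁) (s₂ := fun i => i.1 ∈ P₂) (fun i => Finset.mem_union.1 i.2)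
    (fun i => i.1 ∣ g') hNdeg hM
  have hsum : ∀ a ∈ S, eC p Fq (toK Fq (m₁ * a.1) / toK Fq h₁ + toK Fq (m₂ * a.2) / toK Fq h₂) =
      eC p Fq (toK Fq (m₁ * (a.1 * k₂) + m₂ * (a.2 * k₁)) / toK Fq (∏ i : P, (i : Fq[X]))) := by
    intro a _
    rw [hLprod, toK_add, add_div]
    congr 2
    · rw [← hL₁, ← mul_assoc, toK_mul Fq _ k₂, toK_mul Fq _ k₂,
        mul_div_mul_right _ _ (toK_ne_zero Fq hk₁ne)]
    · rw [← hL₂, ← mul_assoc, toK_mul Fq _ k₁, toK_mul Fq _ k₁,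
        mul_div_mul_right _ _ (toK_ne_zero Fq hk₂ne)]
  rw [finsum_mem_eq_of_bijOn _ hbij hsum (g := fun A : Fq[X] × Fq[X] =>
    eC p Fq (toK Fq (m₁ * A.1 + m₂ * A.2) / toK Fq (∏ i : P, (i : Fq[X])))), finsum_mem_coe_finset]
  refine hbound.trans ?_
  gcongr
  have hcard := htau ((Finset.univ.filter fun i : P => i.1 ∣ g').map (.subtype _))
    (by simp +contextual [Finset.subset_iff])
    (by simp only [Finset.mem_map, Finset.mem_filter]
        rintro _ ⟨i, hi, rfl⟩
        exact hi.2.trans hg'g)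
  rw [Finset.card_map] at hcard
  have hle := hcard.trans (Nat.le_self_pow two_ne_zero _)
  exact_mod_cast hle

end
end

section
/- Let B ≥ 0 and ε > 0. There exists a constant C = C(q, B, ε) > 0 such that for every nonzero r ∈ 𝔽_q[t] and every real X > 0, the sum Σ τ(h₁)^B τ(h₂)^B τ(h₃)^B / (⟨h₁⟩⟨h₂⟩⟨h₃⟩), taken over all triples (h₁, h₂, h₃) of monic squarefree polynomials satisfying max{⟨h₁⟩, ⟨h₂⟩, ⟨h₃⟩} ≥ q^X, h₁ | r·h₂·h₃, h₂ | r·h₁·h₃, and h₃ | r·h₁·h₂, converges and is at most C · ⟨r⟩^ε · q^{X(ε − 1)}. -/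
open Polynomial
open scoped Classical

noncomputable section

variable (Fq : Type) [Field Fq] [Fintype Fq]

section

variable {Fq}

lemma one_lt_card : (1 : ℝ) < Fintype.card Fq := by
  exact_mod_cast Fintype.one_lt_card (α := Fq)

lemma pnorm_of_ne_zero {f : Fq[X]} (hf : f ≠ 0) :
    pnorm Fq f = (Fintype.card Fq : ℝ) ^ f.natDegree := if_neg hf

lemma pnorm_mul (f g : Fq[X]) : pnorm Fq (f * g) = pnorm Fq f * pnorm Fq g := by
  by_cases hf : f = 0
  · simp [pnorm, hf]
  by_cases hg : g = 0
  · simp [pnorm, hg]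
  rw [pnorm_of_ne_zero hf, pnorm_of_ne_zero hg, pnorm_of_ne_zero (mul_ne_zero hf hg),
    natDegree_mul hf hg, pow_add]

lemma one_le_pnorm {f : Fq[X]} (hf : f ≠ 0) : 1 ≤ pnorm Fq f := by
  rw [pnorm_of_ne_zero hf]
  exact one_le_pow₀ one_lt_card.le

lemma pnorm_pos {f : Fq[X]} (hf : f ≠ 0) : 0 < pnorm Fq f :=
  one_pos.trans_le (one_le_pnorm hf)

lemma pnorm_nonneg (f : Fq[X]) : 0 ≤ pnorm Fq f := by
  by_cases hf : f = 0
  · simp [pnorm, hf]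
  · exact (pnorm_pos hf).le

lemma pnorm_le_of_dvd {f g : Fq[X]} (hg : g ≠ 0) (h : f ∣ g) : pnorm Fq f ≤ pnorm Fq g := by
  rw [pnorm_of_ne_zero hg, pnorm_of_ne_zero (ne_zero_of_dvd_ne_zero hg h)]
  exact pow_le_pow_right₀ one_lt_card.le (natDegree_le_of_dvd h hg)

lemma pnorm_prod {ι : Type*} (s : Finset ι) (f : ι → Fq[X]) :
    pnorm Fq (∏ i ∈ s, f i) = ∏ i ∈ s, pnorm Fq (f i) := by
  induction s using Finset.induction_on with
  | empty => simp [pnorm]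
  | insert a s ha ih => rw [Finset.prod_insert ha, Finset.prod_insert ha, pnorm_mul, ih]

lemma injOn_coeff_natDegree_lt {F : Type*} [Field F] (n : ℕ) :
    Set.InjOn (fun (f : F[X]) (i : Fin n) => f.coeff i) {f | f.natDegree < n} := by
  intro f hf g hg h
  ext k
  by_cases hk : k < n
  · exact congrFun h ⟨k, hk⟩
  · rw [coeff_eq_zero_of_natDegree_lt (lt_of_lt_of_le hf (not_lt.1 hk)),
      coeff_eq_zero_of_natDegree_lt (lt_of_lt_of_le hg (not_lt.1 hk))]

lemma finite_natDegree_lt (n : ℕ) : {f : Fq[X] | f.natDegree < n}.Finite :=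
  Set.Finite.of_injOn (Set.mapsTo_univ _ _) (injOn_coeff_natDegree_lt n) Set.finite_univ

lemma card_le_of_natDegree_lt {n : ℕ} {s : Finset Fq[X]} (hs : ∀ f ∈ s, f.natDegree < n) :
    s.card ≤ Fintype.card Fq ^ n := by
  have h := Finset.card_le_card_of_injOn (t := Finset.univ)
    (fun (f : Fq[X]) (i : Fin n) => f.coeff i) (fun _ _ => Finset.mem_univ _)
    ((injOn_coeff_natDegree_lt n).mono (s₁ := (s : Set Fq[X])) hs)
  simpa using h

/-- Sums of `⟨f⟩^(-s)` over finite sets of nonzero polynomials are uniformly bounded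
when `s > 1`. -/
lemma exists_sum_pnorm_rpow_le {s : ℝ} (hs : 1 < s) :
    ∃ Z : ℝ, 0 < Z ∧ ∀ N : Finset Fq[X], (∀ f ∈ N, f ≠ 0) →
      ∑ f ∈ N, pnorm Fq f ^ (-s) ≤ Z := by
  set q : ℝ := ((Fintype.card Fq : ℕ) : ℝ) with hq
  have hq1 : 1 < q := one_lt_card
  have hq0 : 0 < q := one_pos.trans hq1
  have hρ0 : 0 < q ^ (1 - s) := Real.rpow_pos_of_pos hq0 _
  have hρ1 : q ^ (1 - s) < 1 := Real.rpow_lt_one_of_one_lt_of_neg hq1 (by linarith)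
  have hsum := summable_geometric_of_lt_one hρ0.le hρ1
  refine ⟨q * ∑' k : ℕ, (q ^ (1 - s)) ^ k,
    mul_pos hq0 (hsum.tsum_pos (fun _ => by positivity) 0 (by simp)), fun N hN => ?_⟩
  rw [← Finset.sum_fiberwise_of_maps_to (g := natDegree) (t := N.image natDegree)
    (fun f hf => Finset.mem_image_of_mem _ hf)]
  refine le_trans (Finset.sum_le_sum (g := fun k => q * (q ^ (1 - s)) ^ k) fun k _ => ?_) ?_
  · have hval : ∀ f ∈ N.filter (fun f => f.natDegree = k),
        pnorm Fq f ^ (-s) = (q ^ (-s)) ^ k := by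
      intro f hf
      obtain ⟨hfN, rfl⟩ := Finset.mem_filter.1 hf
      rw [pnorm_of_ne_zero (hN f hfN), ← Real.rpow_natCast, ← Real.rpow_mul hq0.le,
        mul_comm, Real.rpow_mul hq0.le, Real.rpow_natCast]
    rw [Finset.sum_congr rfl hval, Finset.sum_const, nsmul_eq_mul]
    have hcard : ((N.filter (fun f => f.natDegree = k)).card : ℝ) ≤ q ^ (k + 1) := by
      rw [hq]
      exact_mod_cast card_le_of_natDegree_lt (n := k + 1) (s := N.filter (fun f => f.natDegree = k))
        (fun f hf => by rw [(Finset.mem_filter.1 hf).2]; exact k.lt_succ_self)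
    calc _ ≤ q ^ (k + 1) * (q ^ (-s)) ^ k := by gcongr
      _ = q * (q ^ (1 - s)) ^ k := by
        rw [sub_eq_add_neg, Real.rpow_add hq0, Real.rpow_one, mul_pow, pow_succ]
        ring
  · rw [← Finset.mul_sum]
    gcongr
    exact hsum.sum_le_tsum _ (fun _ _ => by positivity)

open UniqueFactorizationMonoid in
/-- The divisor bound: `K^(ω(f)) ≪ ⟨f⟩^δ`. -/
lemma exists_pow_card_primeFactors_le {K δ : ℝ} (hK : 1 ≤ K) (hδ : 0 < δ) :
    ∃ C : ℝ, 0 < C ∧ ∀ f : Fq[X], f ≠ 0 →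
      K ^ (primeFactors f).card ≤ C * pnorm Fq f ^ δ := by
  set q : ℝ := ((Fintype.card Fq : ℕ) : ℝ) with hq
  have hq1 : 1 < q := one_lt_card
  have hq0 : 0 < q := one_pos.trans hq1
  obtain ⟨D, hD⟩ := pow_unbounded_of_one_lt K (Real.one_lt_rpow hq1 hδ)
  set S := (finite_natDegree_lt (Fq := Fq) D).toFinset with hS
  refine ⟨K ^ S.card, by positivity, fun f hf => ?_⟩
  have hne : ∀ p ∈ primeFactors f, p ≠ 0 := fun p hp =>
    (prime_of_normalized_factor p (mem_primeFactors.1 hp)).ne_zero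
  calc K ^ (primeFactors f).card = ∏ p ∈ primeFactors f, K := by rw [Finset.prod_const]
    _ ≤ ∏ p ∈ primeFactors f, (if p ∈ S then K else 1) * pnorm Fq p ^ δ := by
      refine Finset.prod_le_prod (fun _ _ => by positivity) fun p hp => ?_
      have h1 := one_le_pnorm (hne p hp)
      split_ifs with hpS
      · exact le_mul_of_one_le_right (by positivity) (Real.one_le_rpow h1 hδ.le)
      · have hdeg : D ≤ p.natDegree := by simpa [hS] using hpS
        rw [one_mul, pnorm_of_ne_zero (hne p hp), ← Real.rpow_natCast, ← Real.rpow_mul hq0.le,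
          mul_comm, Real.rpow_mul hq0.le, Real.rpow_natCast]
        exact hD.le.trans (pow_le_pow_right₀ (Real.one_le_rpow hq1.le hδ.le) hdeg)
    _ = K ^ ((primeFactors f).filter (· ∈ S)).card * pnorm Fq (radical f) ^ δ := by
      rw [Finset.prod_mul_distrib, Finset.prod_ite, Finset.prod_const, Finset.prod_const_one,
        mul_one, Real.finsetProd_rpow _ _ (fun p _ => pnorm_nonneg p), ← pnorm_prod]
      rfl
    _ ≤ K ^ S.card * pnorm Fq f ^ δ := by
      have hcard : ((primeFactors f).filter (· ∈ S)).card ≤ S.card :=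
        Finset.card_le_card fun p hp => (Finset.mem_filter.1 hp).2
      have hrad := pnorm_le_of_dvd hf radical_dvd_self
      have hrad0 := pnorm_nonneg (radical f)
      gcongr

/-- The monic squarefree divisors of `f`. -/
def squarefreeDivisors {F : Type*} [Field F] (f : F[X]) : Set F[X] :=
  {d | d.Monic ∧ Squarefree d ∧ d ∣ f}

open UniqueFactorizationMonoid in
lemma mapsTo_primeFactors_squarefreeDivisors {F : Type*} [Field F] {f : F[X]} (hf : f ≠ 0) :
    Set.MapsTo primeFactors (squarefreeDivisors f) ((primeFactors f).powerset : Finset _) := by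
  rintro d ⟨-, -, hd⟩
  rw [Finset.mem_coe, Finset.mem_powerset]
  intro p hp
  rw [mem_primeFactors] at hp ⊢
  exact Multiset.subset_of_le
    ((dvd_iff_normalizedFactors_le_normalizedFactors (ne_zero_of_dvd_ne_zero hf hd) hf).1 hd) hp

open UniqueFactorizationMonoid in
lemma injOn_primeFactors_squarefreeDivisors {F : Type*} [Field F] (f : F[X]) :
    Set.InjOn primeFactors (squarefreeDivisors f) := by
  rintro d ⟨hdm, hds, -⟩ e ⟨hem, hes, -⟩ h
  refine eq_of_monic_of_associated hdm hem ?_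
  have hd := radical_associated hds.isRadical hdm.ne_zero
  have he := radical_associated hes.isRadical hem.ne_zero
  have : radical d = radical e := by rw [radical, radical, h]
  exact hd.symm.trans (this ▸ he)

lemma finite_squarefreeDivisors {F : Type*} [Field F] {f : F[X]} (hf : f ≠ 0) :
    (squarefreeDivisors f).Finite :=
  Set.Finite.of_injOn (mapsTo_primeFactors_squarefreeDivisors hf)
    (injOn_primeFactors_squarefreeDivisors f) (Finset.finite_toSet _)

open UniqueFactorizationMonoid in
lemma ncard_squarefreeDivisors_le {F : Type*} [Field F] {f : F[X]} (hf : f ≠ 0) :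
    (squarefreeDivisors f).ncard ≤ 2 ^ (primeFactors f).card := by
  rw [← Finset.card_powerset, ← Set.ncard_coe_finset]
  exact Set.ncard_le_ncard_of_injOn _ (mapsTo_primeFactors_squarefreeDivisors hf)
    (injOn_primeFactors_squarefreeDivisors f) (Finset.finite_toSet _)

open UniqueFactorizationMonoid in
lemma tauP_le_of_squarefree_of_dvd {F : Type} [Field F] {h m : F[X]} (hm : m ≠ 0)
    (hh : Squarefree h) (hd : h ∣ m) : tauP F h ≤ 2 ^ (primeFactors m).card :=
  (Set.ncard_le_ncard (t := squarefreeDivisors m)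
    (fun _ h => ⟨h.1, hh.squarefree_of_dvd h.2, h.2.trans hd⟩)
    (finite_squarefreeDivisors hm)).trans (ncard_squarefreeDivisors_le hm)

/-- Two squarefree elements of a Euclidean domain have a squarefree common multiple whose square
divides every common multiple of their squares. -/
lemma exists_squarefree_lcm {R : Type*} [EuclideanDomain R] {a b : R}
    (ha : Squarefree a) (hb : Squarefree b) :
    ∃ m : R, Squarefree m ∧ a ∣ m ∧ b ∣ m ∧ ∀ N, a ^ 2 ∣ N → b ^ 2 ∣ N → m ^ 2 ∣ N := by
  obtain ⟨a', b', hab, hda, hdb⟩ : ∃ a' b', IsCoprime a' b' ∧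
      a = EuclideanDomain.gcd a b * a' ∧ b = EuclideanDomain.gcd a b * b' := by
    have hd0 : EuclideanDomain.gcd a b ≠ 0 := fun h =>
      ha.ne_zero (EuclideanDomain.gcd_eq_zero_iff.1 h).1
    obtain ⟨a', ha'⟩ := EuclideanDomain.gcd_dvd_left a b
    obtain ⟨b', hb'⟩ := EuclideanDomain.gcd_dvd_right a b
    refine ⟨a', b', ⟨EuclideanDomain.gcdA a b, EuclideanDomain.gcdB a b, ?_⟩, ha', hb'⟩
    have h := EuclideanDomain.gcd_eq_gcd_ab a b
    apply mul_left_cancel₀ hd0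
    linear_combination (-1 : R) * h - EuclideanDomain.gcdA a b * ha' - EuclideanDomain.gcdB a b * hb'
  generalize EuclideanDomain.gcd a b = d at hda hdb
  subst hda hdb
  refine ⟨d * a' * b', ?_, dvd_mul_right _ _, ⟨a', by ring⟩, fun N h1 h2 => ?_⟩
  · rw [squarefree_mul_iff]
    exact ⟨IsRelPrime.mul_left (IsRelPrime.of_squarefree_mul hb) hab.isRelPrime, ha,
      hb.of_mul_right⟩
  · obtain ⟨N', rfl⟩ : d ^ 2 ∣ N := (Dvd.intro (a' ^ 2) (by ring)).trans h1
    have hd2 : d ^ 2 ≠ 0 := pow_ne_zero 2 (left_ne_zero_of_mul ha.ne_zero)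
    rw [mul_pow] at h1 h2
    rw [mul_assoc, mul_pow, mul_pow]
    exact mul_dvd_mul_left _ (IsCoprime.mul_dvd hab.pow
      ((mul_dvd_mul_iff_left hd2).1 h1) ((mul_dvd_mul_iff_left hd2).1 h2))

/-- The conditions `hᵢ ∣ r hⱼ hₖ` force the square of a common multiple `g n` of the `hᵢ` to divide
`g h₁ h₂ h₃` for some squarefree `g ∣ r`. -/
lemma exists_factorization_of_dvd {F : Type*} [Field F] {r a b c : F[X]}
    (ha : Squarefree a) (hb : Squarefree b) (hc : Squarefree c)
    (h1 : a ∣ r * b * c) (h2 : b ∣ r * a * c) (h3 : c ∣ r * a * b) :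
    ∃ g n : F[X], g ∈ squarefreeDivisors r ∧ n ≠ 0 ∧ a ∣ g * n ∧ b ∣ g * n ∧ c ∣ g * n ∧
      (g * n) ^ 2 ∣ g * (a * b * c) := by
  obtain ⟨k, hk, hak, hbk, hkN⟩ := exists_squarefree_lcm ha hb
  obtain ⟨m, hm, hkm, hcm, hmN⟩ := exists_squarefree_lcm hk hc
  have hg := normalize_associated (EuclideanDomain.gcd m r)
  have hg0 : EuclideanDomain.gcd m r ≠ 0 := fun h =>
    hm.ne_zero (EuclideanDomain.gcd_eq_zero_iff.1 h).1
  have hgm := hg.dvd.trans (EuclideanDomain.gcd_dvd_left m r)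
  obtain ⟨n, hn⟩ := id hgm
  refine ⟨normalize (EuclideanDomain.gcd m r), n,
    ⟨monic_normalize hg0, hm.squarefree_of_dvd hgm,
      hg.dvd.trans (EuclideanDomain.gcd_dvd_right m r)⟩, ?_, ?_, ?_, ?_, ?_⟩
  · rintro rfl
    exact hm.ne_zero (by simpa using hn)
  · exact hn ▸ hak.trans hkm
  · exact hn ▸ hbk.trans hkm
  · exact hn ▸ hcm
  · rw [← hn]
    have key : ∀ x y : F[X], x ∣ m → x ∣ r * y →
        x ^ 2 ∣ normalize (EuclideanDomain.gcd m r) * (x * y) := by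
      intro x y hxm hxr
      have : x ∣ EuclideanDomain.gcd m r * y := by
        rw [EuclideanDomain.gcd_eq_gcd_ab, add_mul]
        refine dvd_add (((hxm.mul_right _).mul_right _)) ?_
        rw [mul_right_comm]
        exact hxr.mul_right _
      rw [mul_left_comm, sq]
      exact mul_dvd_mul_left _ (this.trans (mul_dvd_mul_right hg.symm.dvd _))
    refine hmN _ (hkN _ ?_ ?_) ?_
    · simpa only [mul_assoc] using key a (b * c) (hak.trans hkm) (by simpa only [mul_assoc] using h1)
    · have := key b (a * c) (hbk.trans hkm) (by simpa only [mul_assoc] using h2)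
      rwa [← mul_assoc b, mul_comm b a] at this
    · have := key c (a * b) hcm (by simpa only [mul_assoc] using h3)
      rwa [mul_comm c] at this

/-- The triples over which the divisor sum is taken. -/
def AdmissibleTriple (r : Fq[X]) (X : ℝ) (t : Fq[X] × Fq[X] × Fq[X]) : Prop :=
  t.1.Monic ∧ Squarefree t.1 ∧ t.2.1.Monic ∧ Squarefree t.2.1 ∧
    t.2.2.Monic ∧ Squarefree t.2.2 ∧
    (Fintype.card Fq : ℝ) ^ X ≤ max (pnorm Fq t.1) (max (pnorm Fq t.2.1) (pnorm Fq t.2.2)) ∧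
    t.1 ∣ r * t.2.1 * t.2.2 ∧ t.2.1 ∣ r * t.1 * t.2.2 ∧ t.2.2 ∣ r * t.1 * t.2.1

/-- The summand of the divisor sum. -/
def tripleWeight (B : ℝ) (t : Fq[X] × Fq[X] × Fq[X]) : ℝ :=
  (tauP Fq t.1 : ℝ) ^ B * (tauP Fq t.2.1 : ℝ) ^ B * (tauP Fq t.2.2 : ℝ) ^ B /
    (pnorm Fq t.1 * pnorm Fq t.2.1 * pnorm Fq t.2.2)

lemma tripleWeight_nonneg (B : ℝ) (t : Fq[X] × Fq[X] × Fq[X]) : 0 ≤ tripleWeight B t := by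
  have := pnorm_nonneg (Fq := Fq)
  exact div_nonneg (by positivity) (mul_nonneg (mul_nonneg (this _) (this _)) (this _))

lemma inv_le_mul_rpow_mul_rpow {H G M Q ε : ℝ} (hH : 0 < H) (hM : 0 < M) (hQ : 0 < Q)
    (hMGH : M ^ 2 ≤ G * H) (hQM : Q ≤ M) (hε : ε ≤ 1) :
    H⁻¹ ≤ G * M ^ (-1 - ε) * Q ^ (ε - 1) := by
  have h1 : H⁻¹ ≤ G / M ^ 2 := by
    rw [inv_eq_one_div, div_le_div_iff₀ hH (by positivity)]
    linarith
  have h2 : 1 ≤ M ^ (1 - ε) * Q ^ (ε - 1) := by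
    rw [← neg_sub 1 ε, Real.rpow_neg hQ.le, ← div_eq_mul_inv, one_le_div (by positivity)]
    exact Real.rpow_le_rpow hQ.le hQM (by linarith)
  have h3 : M ^ (-1 - ε) = M ^ (1 - ε) / M ^ 2 := by
    rw [← Real.rpow_natCast, ← Real.rpow_sub hM]
    congr 1
    push_cast
    ring
  calc H⁻¹ ≤ G / M ^ 2 := h1
    _ ≤ G / M ^ 2 * (M ^ (1 - ε) * Q ^ (ε - 1)) :=
      le_mul_of_one_le_right ((inv_pos.2 hH).le.trans h1) h2
    _ = _ := by rw [h3]; ring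

open UniqueFactorizationMonoid in
lemma AdmissibleTriple.exists_factorization {B ε : ℝ} (hB : 0 ≤ B) (hε : ε ≤ 1) {r : Fq[X]}
    {X : ℝ} {t : Fq[X] × Fq[X] × Fq[X]} (ht : AdmissibleTriple r X t) :
    ∃ p : Fq[X] × Fq[X], p.1 ∈ squarefreeDivisors r ∧ p.2 ≠ 0 ∧
      t ∈ squarefreeDivisors (p.1 * p.2) ×ˢ squarefreeDivisors (p.1 * p.2) ×ˢ
        squarefreeDivisors (p.1 * p.2) ∧
      tripleWeight B t ≤ (((2 : ℝ) ^ B) ^ 3) ^ (primeFactors (p.1 * p.2)).card *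
        (pnorm Fq p.1 * pnorm Fq (p.1 * p.2) ^ (-1 - ε) *
          ((Fintype.card Fq : ℝ) ^ X) ^ (ε - 1)) := by
  obtain ⟨a, b, c⟩ := t
  obtain ⟨ham, has, hbm, hbs, hcm, hcs, hmax, h1, h2, h3⟩ := ht
  dsimp only at *
  obtain ⟨g, n, hg, hn, ha, hb, hc, hsq⟩ := exists_factorization_of_dvd has hbs hcs h1 h2 h3
  refine ⟨(g, n), hg, hn, ⟨⟨ham, has, ha⟩, ⟨hbm, hbs, hb⟩, ⟨hcm, hcs, hc⟩⟩, ?_⟩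
  dsimp only
  have hg0 : g ≠ 0 := hg.1.ne_zero
  have hm0 : g * n ≠ 0 := mul_ne_zero hg0 hn
  have hN0 : a * b * c ≠ 0 := mul_ne_zero (mul_ne_zero ham.ne_zero hbm.ne_zero) hcm.ne_zero
  have hτ : ∀ h : Fq[X], Squarefree h → h ∣ g * n →
      (tauP Fq h : ℝ) ^ B ≤ ((2 : ℝ) ^ B) ^ (primeFactors (g * n)).card := by
    intro h hhs hhd
    rw [← Real.rpow_natCast, ← Real.rpow_mul (by norm_num), mul_comm, Real.rpow_mul (by norm_num),
      Real.rpow_natCast]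
    refine Real.rpow_le_rpow (Nat.cast_nonneg _) ?_ hB
    exact_mod_cast tauP_le_of_squarefree_of_dvd hm0 hhs hhd
  have hQM : (Fintype.card Fq : ℝ) ^ X ≤ pnorm Fq (g * n) :=
    hmax.trans (max_le (pnorm_le_of_dvd hm0 ha)
      (max_le (pnorm_le_of_dvd hm0 hb) (pnorm_le_of_dvd hm0 hc)))
  have hle := pnorm_le_of_dvd (mul_ne_zero hg0 hN0) hsq
  rw [sq, pnorm_mul, ← sq, pnorm_mul g (a * b * c)] at hle
  have hinv := inv_le_mul_rpow_mul_rpow (pnorm_pos hN0) (pnorm_pos hm0)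
    (Real.rpow_pos_of_pos (one_pos.trans one_lt_card) X) hle hQM hε
  rw [tripleWeight, div_eq_mul_inv, ← pnorm_mul, ← pnorm_mul, ← pow_mul, mul_comm 3, pow_mul,
    pow_succ, sq]
  refine mul_le_mul ?_ hinv (inv_nonneg.2 (pnorm_nonneg _)) (by positivity)
  exact mul_le_mul (mul_le_mul (hτ a has ha) (hτ b hbs hb) (by positivity) (by positivity))
    (hτ c hcs hc) (by positivity) (by positivity)

open UniqueFactorizationMonoid in
lemma exists_sum_tripleWeight_le {B ε : ℝ} (hB : 0 ≤ B) (hε : 0 < ε) (hε1 : ε ≤ 1) :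
    ∃ C : ℝ, 0 < C ∧ ∀ r : Fq[X], r ≠ 0 → ∀ (X : ℝ) (u : Finset {t // AdmissibleTriple r X t}),
      ∑ t ∈ u, tripleWeight B t.1 ≤
        C * pnorm Fq r ^ ε * ((Fintype.card Fq : ℝ) ^ X) ^ (ε - 1) := by
  obtain ⟨C₁, hC₁, hdiv⟩ := exists_pow_card_primeFactors_le (Fq := Fq)
    (K := 2 ^ 3 * ((2 : ℝ) ^ B) ^ 3) (δ := ε / 2)
    (one_le_mul_of_one_le_of_one_le (by norm_num)
      (one_le_pow₀ (Real.one_le_rpow (by norm_num) hB))) (by positivity)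
  obtain ⟨C₂, hC₂, hcount⟩ := exists_pow_card_primeFactors_le (Fq := Fq) one_le_two hε
  obtain ⟨Z, hZ, hsum⟩ := exists_sum_pnorm_rpow_le (Fq := Fq) (s := 1 + ε / 2) (by linarith)
  refine ⟨C₂ * C₁ * Z, by positivity, fun r hr X u => ?_⟩
  choose φ hφ1 hφ2 hφ3 hφ using fun t : {t // AdmissibleTriple r X t} =>
    t.2.exists_factorization hB hε1
  set E : ℝ := ((Fintype.card Fq : ℝ) ^ X) ^ (ε - 1) with hE
  have hE0 : 0 < E :=
    Real.rpow_pos_of_pos (Real.rpow_pos_of_pos (one_pos.trans one_lt_card) X) _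
  set F : Fq[X] × Fq[X] → ℝ := fun p => (((2 : ℝ) ^ B) ^ 3) ^ (primeFactors (p.1 * p.2)).card *
        (pnorm Fq p.1 * pnorm Fq (p.1 * p.2) ^ (-1 - ε) * E) with hF
  have hF0 : ∀ p, 0 ≤ F p := fun p => mul_nonneg (by positivity)
    (mul_nonneg (mul_nonneg (pnorm_nonneg _) (Real.rpow_nonneg (pnorm_nonneg _) _)) hE0.le)
  have hne : ∀ p ∈ u.image φ, p.1 ≠ 0 ∧ p.2 ≠ 0 := by
    intro p hp
    obtain ⟨t, -, rfl⟩ := Finset.mem_image.1 hp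
    exact ⟨(hφ1 t).1.ne_zero, hφ2 t⟩
  have hfiber : ∀ p ∈ u.image φ, ((u.filter (fun t => φ t = p)).card : ℝ) ≤
      (2 ^ 3) ^ (primeFactors (p.1 * p.2)).card := by
    intro p hp
    have hp0 : p.1 * p.2 ≠ 0 := mul_ne_zero (hne p hp).1 (hne p hp).2
    have hfin := finite_squarefreeDivisors hp0
    have hcard : (u.filter (fun t => φ t = p)).card ≤
        (squarefreeDivisors (p.1 * p.2) ×ˢ squarefreeDivisors (p.1 * p.2) ×ˢ
          squarefreeDivisors (p.1 * p.2)).ncard := by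
      rw [← Set.ncard_coe_finset]
      refine Set.ncard_le_ncard_of_injOn Subtype.val (fun t ht => ?_)
        Subtype.val_injective.injOn (hfin.prod (hfin.prod hfin))
      rw [← (Finset.mem_filter.1 ht).2]
      exact hφ3 t
    rw [Set.ncard_prod, Set.ncard_prod] at hcard
    have h := ncard_squarefreeDivisors_le hp0
    rw [← pow_mul, mul_comm 3, pow_mul, pow_three]
    exact_mod_cast hcard.trans (Nat.mul_le_mul h (Nat.mul_le_mul h h))
  have hterm : ∀ p ∈ u.image φ, (u.filter (fun t => φ t = p)).card • F p ≤
      C₁ * E * pnorm Fq p.2 ^ (-(1 + ε / 2)) := by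
    intro p hp
    obtain ⟨hg0, hn0⟩ := hne p hp
    have hm0 := mul_ne_zero hg0 hn0
    have hg := pnorm_pos hg0
    have hn := pnorm_pos hn0
    have hm := pnorm_pos hm0
    have hexp : pnorm Fq (p.1 * p.2) ^ (ε / 2) * pnorm Fq (p.1 * p.2) ^ (-1 - ε) =
        pnorm Fq p.1 ^ (-(1 + ε / 2)) * pnorm Fq p.2 ^ (-(1 + ε / 2)) := by
      rw [← Real.rpow_add hm, ← Real.mul_rpow hg.le hn.le, ← pnorm_mul]
      congr 1
      ring
    have hg1 : pnorm Fq p.1 * pnorm Fq p.1 ^ (-(1 + ε / 2)) ≤ 1 := by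
      rw [← Real.rpow_one_add' hg.le (by linarith)]
      exact Real.rpow_le_one_of_one_le_of_nonpos (one_le_pnorm hg0) (by linarith)
    calc (u.filter (fun t => φ t = p)).card • F p
        ≤ (2 ^ 3) ^ (primeFactors (p.1 * p.2)).card * F p := by
          rw [nsmul_eq_mul]
          exact mul_le_mul_of_nonneg_right (hfiber p hp) (hF0 p)
      _ = (2 ^ 3 * ((2 : ℝ) ^ B) ^ 3) ^ (primeFactors (p.1 * p.2)).card *
          (pnorm Fq p.1 * pnorm Fq (p.1 * p.2) ^ (-1 - ε) * E) := by
          rw [hF, mul_pow, mul_assoc]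
      _ ≤ C₁ * pnorm Fq (p.1 * p.2) ^ (ε / 2) *
          (pnorm Fq p.1 * pnorm Fq (p.1 * p.2) ^ (-1 - ε) * E) :=
          mul_le_mul_of_nonneg_right (hdiv _ hm0) (by positivity)
      _ = C₁ * E * pnorm Fq p.2 ^ (-(1 + ε / 2)) *
          (pnorm Fq p.1 * pnorm Fq p.1 ^ (-(1 + ε / 2))) := by
          linear_combination (C₁ * pnorm Fq p.1 * E) * hexp
      _ ≤ C₁ * E * pnorm Fq p.2 ^ (-(1 + ε / 2)) :=
          mul_le_of_le_one_right (by positivity) hg1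
  set S := (finite_squarefreeDivisors hr).toFinset with hS
  set N := (u.image φ).image Prod.snd with hN
  have hsub : u.image φ ⊆ S ×ˢ N := by
    intro p hp
    refine Finset.mem_product.2 ⟨?_, Finset.mem_image_of_mem _ hp⟩
    obtain ⟨t, -, rfl⟩ := Finset.mem_image.1 hp
    simpa [hS] using hφ1 t
  have hN0 : ∀ f ∈ N, f ≠ 0 := by
    intro f hf
    obtain ⟨p, hp, rfl⟩ := Finset.mem_image.1 hf
    exact (hne p hp).2
  have hScard : (S.card : ℝ) ≤ C₂ * pnorm Fq r ^ ε := by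
    refine le_trans ?_ (hcount r hr)
    rw [hS, ← Set.ncard_eq_toFinset_card _ (finite_squarefreeDivisors hr)]
    exact_mod_cast ncard_squarefreeDivisors_le hr
  calc ∑ t ∈ u, tripleWeight B t.1 ≤ ∑ t ∈ u, F (φ t) := Finset.sum_le_sum fun t _ => hφ t
    _ = ∑ p ∈ u.image φ, (u.filter (fun t => φ t = p)).card • F p := Finset.sum_comp F φ
    _ ≤ ∑ p ∈ u.image φ, C₁ * E * pnorm Fq p.2 ^ (-(1 + ε / 2)) := Finset.sum_le_sum hterm
    _ ≤ ∑ p ∈ S ×ˢ N, C₁ * E * pnorm Fq p.2 ^ (-(1 + ε / 2)) :=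
      Finset.sum_le_sum_of_subset_of_nonneg hsub fun p _ _ =>
        mul_nonneg (by positivity) (Real.rpow_nonneg (pnorm_nonneg _) _)
    _ = S.card * (C₁ * E * ∑ f ∈ N, pnorm Fq f ^ (-(1 + ε / 2))) := by
      simp only [Finset.sum_product, Finset.sum_const, nsmul_eq_mul, Finset.mul_sum]
    _ ≤ C₂ * pnorm Fq r ^ ε * (C₁ * E * Z) :=
      mul_le_mul hScard (mul_le_mul_of_nonneg_left (hsum N hN0) (by positivity))
        (mul_nonneg (by positivity)
          (Finset.sum_nonneg fun f _ => Real.rpow_nonneg (pnorm_nonneg f) _))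
        (mul_nonneg hC₂.le (Real.rpow_nonneg (pnorm_nonneg r) _))
    _ = _ := by ring

end

/-- Triple divisor sum bound: the sum of `τ(h₁)^B τ(h₂)^B τ(h₃)^B/(⟨h₁⟩⟨h₂⟩⟨h₃⟩)` over monic
squarefree triples with `max ⟨hᵢ⟩ ≥ q^X` and `hᵢ ∣ r·hⱼ·hₖ` converges and is
`≤ C·⟨r⟩^ε·q^(X(ε−1))`. -/
theorem triple_divisor_sum_bound (B ε : ℝ) (hB : 0 ≤ B) (hε : 0 < ε) :
    ∃ C : ℝ, 0 < C ∧
      ∀ (r : Polynomial Fq), r ≠ 0 → ∀ X : ℝ, 0 < X →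
        Summable (fun t : {t : Polynomial Fq × Polynomial Fq × Polynomial Fq //
            t.1.Monic ∧ Squarefree t.1 ∧ t.2.1.Monic ∧ Squarefree t.2.1 ∧
            t.2.2.Monic ∧ Squarefree t.2.2 ∧
            (Fintype.card Fq : ℝ) ^ X ≤
              max (pnorm Fq t.1) (max (pnorm Fq t.2.1) (pnorm Fq t.2.2)) ∧
            t.1 ∣ r * t.2.1 * t.2.2 ∧ t.2.1 ∣ r * t.1 * t.2.2 ∧ t.2.2 ∣ r * t.1 * t.2.1} =>
          (tauP Fq t.1.1 : ℝ) ^ B * (tauP Fq t.1.2.1 : ℝ) ^ B * (tauP Fq t.1.2.2 : ℝ) ^ B /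
            (pnorm Fq t.1.1 * pnorm Fq t.1.2.1 * pnorm Fq t.1.2.2)) ∧
        (∑' t : {t : Polynomial Fq × Polynomial Fq × Polynomial Fq //
            t.1.Monic ∧ Squarefree t.1 ∧ t.2.1.Monic ∧ Squarefree t.2.1 ∧
            t.2.2.Monic ∧ Squarefree t.2.2 ∧
            (Fintype.card Fq : ℝ) ^ X ≤
              max (pnorm Fq t.1) (max (pnorm Fq t.2.1) (pnorm Fq t.2.2)) ∧
            t.1 ∣ r * t.2.1 * t.2.2 ∧ t.2.1 ∣ r * t.1 * t.2.2 ∧ t.2.2 ∣ r * t.1 * t.2.1},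
          (tauP Fq t.1.1 : ℝ) ^ B * (tauP Fq t.1.2.1 : ℝ) ^ B * (tauP Fq t.1.2.2 : ℝ) ^ B /
            (pnorm Fq t.1.1 * pnorm Fq t.1.2.1 * pnorm Fq t.1.2.2)) ≤
          C * pnorm Fq r ^ ε * (Fintype.card Fq : ℝ) ^ (X * (ε - 1)) := by
  obtain ⟨C, hC, hbound⟩ := exists_sum_tripleWeight_le (Fq := Fq) hB (lt_min hε one_pos)
    (min_le_right ε 1)
  refine ⟨C, hC, fun r hr X hX => ?_⟩
  have hle : ∀ u : Finset {t // AdmissibleTriple r X t}, ∑ t ∈ u, tripleWeight B t.1 ≤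
      C * pnorm Fq r ^ ε * (Fintype.card Fq : ℝ) ^ (X * (ε - 1)) := by
    intro u
    have hq : (1 : ℝ) < Fintype.card Fq := one_lt_card
    refine (hbound r hr X u).trans ?_
    rw [← Real.rpow_mul (one_pos.trans hq).le]
    have hr1 := one_le_pnorm hr
    have hmin := min_le_left ε 1
    have hq1 := hq.le
    gcongr
  exact ⟨summable_of_sum_le (fun t => tripleWeight_nonneg B t.1) hle,
    Real.tsum_le_of_sum_le (fun t => tripleWeight_nonneg B t.1) hle⟩

end
end
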